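/- Let X be a Banach space with a Schauder basis and let W_2 ⊆ W_1 be infinite-dimensional block subspaces of X. Then K(W_2) ⊆ K(W_1), and if moreover W_2 has finite codimension in W_1, then K(W_2) = K(W_1). -/

import Mathlib

open scoped ENNReal
open Filter Topology

/-- The `ℓ_p` norm of a finite real sequence, `(∑ |a i|^p)^(1/p)` for `p < ∞`
and `max |a i|` for `p = ∞`. -/
noncomputable def lpNorm (p : ℝ≥0∞) {n : ℕ} (a : Fin n → ℝ) : ℝ :=
  if p = ∞ then ⨆ i, |a i| else (∑ i, |a i| ^ p.toReal) ^ (1 / p.toReal)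

/-- `e` is a Schauder basis of `X`: every vector has a unique representation as a
norm-convergent series `∑ a i • e i`. -/
def IsSchauderBasis {X : Type*} [NormedAddCommGroup X] [NormedSpace ℝ X] (e : ℕ → X) : Prop :=
  ∀ x : X, ∃! a : ℕ → ℝ,
    Tendsto (fun n => ∑ i ∈ Finset.range n, a i • e i) atTop (𝓝 x)

/-- `y` is an (infinite) block basic sequence of `e`: a sequence of nonzero vectors with
finite, successively ordered supports with respect to `e`. -/
def IsBlockSeq {X : Type*} [NormedAddCommGroup X] [NormedSpace ℝ X] (e : ℕ → X) (y : ℕ → X) : Prop :=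
  ∃ N : ℕ → ℕ, StrictMono N ∧ ∀ k, y k ≠ 0 ∧
    y k ∈ Submodule.span ℝ (e '' Set.Ico (N k) (N (k + 1)))

/-- A block subspace: the closed linear span of an infinite block basic sequence of `e`. -/
def IsBlockSubspace {X : Type*} [NormedAddCommGroup X] [NormedSpace ℝ X] (e : ℕ → X)
    (Y : Submodule ℝ X) : Prop :=
  ∃ y : ℕ → X, IsBlockSeq e y ∧ Y = (Submodule.span ℝ (Set.range y)).topologicalClosure

/-- `y` is a finite block basic sequence of `e` (length `n`): nonzero vectors with
finite, successively ordered supports with respect to `e`. -/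
def IsFinBlockSeq {X : Type*} [NormedAddCommGroup X] [NormedSpace ℝ X] (e : ℕ → X) {n : ℕ}
    (y : Fin n → X) : Prop :=
  ∃ N : ℕ → ℕ, StrictMono N ∧ ∀ k : Fin n, y k ≠ 0 ∧
    y k ∈ Submodule.span ℝ (e '' Set.Ico (N k.val) (N (k.val + 1)))

/-- `(y i)_{i<n}` is `C`-equivalent to the unit vector basis of `ℓ_p^n`
(of `c_0^n`, i.e. `ℓ_∞^n`, when `p = ∞`). -/
def FinLpEquiv {X : Type*} [NormedAddCommGroup X] [NormedSpace ℝ X] (C : ℝ) (p : ℝ≥0∞) {n : ℕ}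
    (y : Fin n → X) : Prop :=
  ∀ a : Fin n → ℝ,
    C⁻¹ * lpNorm p a ≤ ‖∑ i, a i • y i‖ ∧ ‖∑ i, a i • y i‖ ≤ C * lpNorm p a

/-- The Krivine set `K(W)`: the set of `p ∈ [1, ∞]` such that `ℓ_p` (or `c_0` when `p = ∞`)
is finitely block represented in `W`, i.e. for every `n` and `ε > 0` there is a normalized
block basic sequence of length `n` with entries in `W` that is `(1+ε)`-equivalent to the
unit vector basis of `ℓ_p^n`. -/
def KrivineSet {X : Type*} [NormedAddCommGroup X] [NormedSpace ℝ X] (e : ℕ → X)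
    (W : Submodule ℝ X) : Set ℝ≥0∞ :=
  {p | 1 ≤ p ∧ ∀ (n : ℕ) (ε : ℝ), 0 < ε → ∃ y : Fin n → X,
    IsFinBlockSeq e y ∧ (∀ i, ‖y i‖ = 1 ∧ y i ∈ W) ∧ FinLpEquiv (1 + ε) p y}

theorem lpNorm_nonneg (p : ℝ≥0∞) {n : ℕ} (a : Fin n → ℝ) : 0 ≤ lpNorm p a := by
  unfold lpNorm
  split_ifs
  · exact Real.iSup_nonneg fun i => abs_nonneg _
  · positivity

theorem lpNorm_pos {p : ℝ≥0∞} {n : ℕ} {a : Fin n → ℝ} (ha : a ≠ 0) : 0 < lpNorm p a := by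
  obtain ⟨i, hi⟩ := Function.ne_iff.1 ha
  have hi' : 0 < |a i| := abs_pos.2 hi
  unfold lpNorm
  split_ifs
  · exact hi'.trans_le (le_ciSup (f := fun i => |a i|) (Set.finite_range _).bddAbove i)
  · refine Real.rpow_pos_of_pos ?_ _
    exact Finset.sum_pos' (fun j _ => by positivity) ⟨i, Finset.mem_univ _, by positivity⟩

theorem lpNorm_mono (p : ℝ≥0∞) {n : ℕ} {a b : Fin n → ℝ} (h : ∀ i, |a i| ≤ |b i|) :
    lpNorm p a ≤ lpNorm p b := by
  unfold lpNorm
  split_ifs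
  · exact ciSup_mono (Set.finite_range _).bddAbove h
  · have := p.toReal_nonneg
    refine Real.rpow_le_rpow (by positivity) (Finset.sum_le_sum fun i _ => ?_) (by positivity)
    exact Real.rpow_le_rpow (abs_nonneg _) (h i) this

theorem toReal_pos_of_one_le {p : ℝ≥0∞} (hp : 1 ≤ p) (hp' : p ≠ ∞) : 0 < p.toReal :=
  ENNReal.toReal_pos (one_pos.trans_le hp).ne' hp'

theorem lpNorm_const_mul {p : ℝ≥0∞} (hp : 1 ≤ p) {n : ℕ} (c : ℝ) (a : Fin n → ℝ) :
    lpNorm p (fun i => a i * c) = lpNorm p a * |c| := by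
  unfold lpNorm
  split_ifs with h
  · simp only [abs_mul]
    rw [Real.iSup_mul_of_nonneg (abs_nonneg c)]
  · have hp0 := toReal_pos_of_one_le hp h
    simp only [abs_mul, Real.mul_rpow (abs_nonneg _) (abs_nonneg _)]
    rw [← Finset.sum_mul, Real.mul_rpow (by positivity) (by positivity),
      ← Real.rpow_mul (abs_nonneg c), mul_one_div_cancel hp0.ne', Real.rpow_one]

/-- The `ℓ_p` norm of a concatenation of blocks is the `ℓ_p` norm of the norms of the blocks. -/
theorem lpNorm_blocks {p : ℝ≥0∞} (hp : 1 ≤ p) {n k : ℕ} (b : Fin n → ℝ)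
    (a : Fin n → Fin k → ℝ) :
    lpNorm p (fun t : Fin (n * k) =>
        b (finProdFinEquiv.symm t).1 * a (finProdFinEquiv.symm t).1 (finProdFinEquiv.symm t).2) =
      lpNorm p (fun i => b i * lpNorm p (a i)) := by
  unfold lpNorm
  split_ifs with h
  · apply le_antisymm
    · refine Real.iSup_le (fun t => ?_) (Real.iSup_nonneg fun i => abs_nonneg _)
      refine le_trans ?_ (le_ciSup (f := fun i => |b i * (⨆ j, |a i j|)|)
        (Set.finite_range _).bddAbove (finProdFinEquiv.symm t).1)
      rw [abs_mul, abs_mul]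
      exact mul_le_mul_of_nonneg_left ((le_ciSup (f := fun j => |a (finProdFinEquiv.symm t).1 j|)
        (Set.finite_range _).bddAbove _).trans (le_abs_self _)) (abs_nonneg _)
    · refine Real.iSup_le (fun i => ?_) (Real.iSup_nonneg fun i => abs_nonneg _)
      rw [abs_mul, abs_of_nonneg (a := ⨆ j, |a i j|) (Real.iSup_nonneg fun i => abs_nonneg _),
        Real.mul_iSup_of_nonneg (abs_nonneg _)]
      refine Real.iSup_le (fun j => ?_) (Real.iSup_nonneg fun i => abs_nonneg _)
      have := le_ciSup (f := fun t : Fin (n * k) => |b (finProdFinEquiv.symm t).1 *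
        a (finProdFinEquiv.symm t).1 (finProdFinEquiv.symm t).2|)
        (Set.finite_range _).bddAbove (finProdFinEquiv (i, j))
      simpa [abs_mul] using this
  · have hp0 := toReal_pos_of_one_le hp h
    congr 1
    rw [← finProdFinEquiv.sum_comp, Fintype.sum_prod_type]
    refine Finset.sum_congr rfl fun i _ => ?_
    have h0 : 0 ≤ ∑ j, |a i j| ^ p.toReal := by positivity
    simp only [Equiv.symm_apply_apply, abs_mul, Real.mul_rpow (abs_nonneg _) (abs_nonneg _)]
    rw [← Finset.mul_sum, abs_of_nonneg (Real.rpow_nonneg h0 _), ← Real.rpow_mul h0,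
      one_div_mul_cancel hp0.ne', Real.rpow_one]

theorem sum_smul_blocks {X : Type*} [AddCommGroup X] [Module ℝ X] {n k : ℕ} (b : Fin n → ℝ)
    (a : Fin n → Fin k → ℝ) (x : Fin (n * k) → X) :
    ∑ i, b i • ∑ j, a i j • x (finProdFinEquiv (i, j)) =
      ∑ t, (b (finProdFinEquiv.symm t).1 *
        a (finProdFinEquiv.symm t).1 (finProdFinEquiv.symm t).2) • x t := by
  rw [← finProdFinEquiv.sum_comp, Fintype.sum_prod_type]
  simp [Finset.smul_sum, smul_smul]

theorem IsFinBlockSeq.blocks {X : Type*} [NormedAddCommGroup X] [NormedSpace ℝ X] {e : ℕ → X}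
    {n k : ℕ} (hk : 0 < k) {x : Fin (n * k) → X} (hx : IsFinBlockSeq e x)
    (a : Fin n → Fin k → ℝ) (ha : ∀ i, ∑ j, a i j • x (finProdFinEquiv (i, j)) ≠ 0) :
    IsFinBlockSeq e (fun i => ∑ j, a i j • x (finProdFinEquiv (i, j))) := by
  obtain ⟨N, hN, hx⟩ := hx
  refine ⟨fun i => N (k * i), hN.comp (strictMono_mul_left_of_pos hk), fun i => ⟨ha i, ?_⟩⟩
  refine Submodule.sum_mem _ fun j _ => Submodule.smul_mem _ _ ?_
  refine Submodule.span_mono (Set.image_mono (Set.Ico_subset_Ico ?_ ?_)) (hx _).2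
  · exact hN.monotone (by simp)
  · refine hN.monotone ?_
    have := j.2
    simp only [finProdFinEquiv_apply_val]
    rw [mul_add]
    omega

theorem exists_ne_zero_sum_smul_mem {X : Type*} [AddCommGroup X] [Module ℝ X]
    {W₁ W₂ : Submodule ℝ X} [FiniteDimensional ℝ (W₁ ⧸ Submodule.comap W₁.subtype W₂)] {k : ℕ}
    (hk : Module.finrank ℝ (W₁ ⧸ Submodule.comap W₁.subtype W₂) < k) (x : Fin k → X)
    (hx : ∀ j, x j ∈ W₁) : ∃ a : Fin k → ℝ, a ≠ 0 ∧ ∑ j, a j • x j ∈ W₂ := by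
  let f := (Submodule.mkQ (Submodule.comap W₁.subtype W₂)).comp
    (Fintype.linearCombination ℝ fun j => (⟨x j, hx j⟩ : W₁))
  obtain ⟨a, ha, ha0⟩ := Submodule.exists_mem_ne_zero_of_ne_bot
    (LinearMap.ker_ne_bot_of_finrank_lt (f := f) (by simpa using hk))
  refine ⟨a, ha0, ?_⟩
  have h : Fintype.linearCombination ℝ (fun j => (⟨x j, hx j⟩ : W₁)) a ∈
      Submodule.comap W₁.subtype W₂ := by
    simpa [f] using ha
  simpa [Fintype.linearCombination_apply] using h

theorem FinLpEquiv.blocks {X : Type*} [NormedAddCommGroup X] [NormedSpace ℝ X] {C : ℝ}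
    (hC : 0 < C) {p : ℝ≥0∞} (hp : 1 ≤ p) {n k : ℕ} {x : Fin (n * k) → X} (hx : FinLpEquiv C p x)
    (a : Fin n → Fin k → ℝ) (ha : ∀ i, C⁻¹ ≤ lpNorm p (a i) ∧ lpNorm p (a i) ≤ C) :
    FinLpEquiv (C * C) p (fun i => ∑ j, a i j • x (finProdFinEquiv (i, j))) := by
  intro b
  rw [sum_smul_blocks]
  obtain ⟨hl, hu⟩ := hx fun t => b (finProdFinEquiv.symm t).1 *
    a (finProdFinEquiv.symm t).1 (finProdFinEquiv.symm t).2
  rw [lpNorm_blocks hp] at hl hu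
  have hlow : lpNorm p b * C⁻¹ ≤ lpNorm p (fun i => b i * lpNorm p (a i)) := by
    rw [← abs_of_pos (inv_pos.2 hC), ← lpNorm_const_mul hp]
    refine lpNorm_mono p fun i => ?_
    rw [abs_mul, abs_mul, abs_of_pos (inv_pos.2 hC), abs_of_nonneg (lpNorm_nonneg _ _)]
    gcongr
    exact (ha i).1
  have hupp : lpNorm p (fun i => b i * lpNorm p (a i)) ≤ lpNorm p b * C := by
    rw [← abs_of_pos hC, ← lpNorm_const_mul hp]
    refine lpNorm_mono p fun i => ?_
    rw [abs_mul, abs_mul, abs_of_pos hC, abs_of_nonneg (lpNorm_nonneg _ _)]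
    gcongr
    exact (ha i).2
  constructor
  · refine le_trans (le_of_eq_of_le ?_ (mul_le_mul_of_nonneg_left hlow (inv_pos.2 hC).le)) hl
    rw [mul_inv]
    ring
  · refine hu.trans ((mul_le_mul_of_nonneg_left hupp hC.le).trans_eq ?_)
    ring

theorem FinLpEquiv.mono {X : Type*} [NormedAddCommGroup X] [NormedSpace ℝ X] {C D : ℝ}
    (hC : 0 < C) (hCD : C ≤ D) {p : ℝ≥0∞} {n : ℕ} {x : Fin n → X} (hx : FinLpEquiv C p x) :
    FinLpEquiv D p x := by
  intro a
  have h0 := lpNorm_nonneg p a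
  exact ⟨le_trans (by gcongr) (hx a).1, (hx a).2.trans (by gcongr)⟩

theorem FinLpEquiv.norm_block {X : Type*} [NormedAddCommGroup X] [NormedSpace ℝ X] {C : ℝ}
    {p : ℝ≥0∞} (hp : 1 ≤ p) {n k : ℕ} {x : Fin (n * k) → X}
    (hx : FinLpEquiv C p x) (i : Fin n) (a : Fin k → ℝ) :
    C⁻¹ * lpNorm p a ≤ ‖∑ j, a j • x (finProdFinEquiv (i, j))‖ ∧
      ‖∑ j, a j • x (finProdFinEquiv (i, j))‖ ≤ C * lpNorm p a := by
  have hsingle : lpNorm p (fun l => (Pi.single i 1 : Fin n → ℝ) l * lpNorm p a) = lpNorm p a := by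
    rw [lpNorm_const_mul hp, abs_of_nonneg (lpNorm_nonneg _ _)]
    suffices h : lpNorm p (Pi.single i 1 : Fin n → ℝ) = 1 by rw [h, one_mul]
    unfold lpNorm
    split_ifs with h
    · apply le_antisymm
      · refine Real.iSup_le (fun l => ?_) zero_le_one
        rcases eq_or_ne l i with rfl | hl
        · simp
        · simp [hl]
      · refine le_trans ?_ (le_ciSup (Set.finite_range _).bddAbove i)
        simp
    · have hp0 := toReal_pos_of_one_le hp h
      rw [Finset.sum_eq_single i (fun l _ hl => by simp [hl, hp0.ne']) (by simp)]
      simp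
  have hsum : ∑ t, ((Pi.single i 1 : Fin n → ℝ) (finProdFinEquiv.symm t).1 *
      a (finProdFinEquiv.symm t).2) • x t = ∑ j, a j • x (finProdFinEquiv (i, j)) := by
    rw [← sum_smul_blocks (Pi.single i 1) (fun _ => a),
      Finset.sum_eq_single i (fun l _ hl => by simp [hl]) (by simp)]
    simp
  have := hx fun t => (Pi.single i 1 : Fin n → ℝ) (finProdFinEquiv.symm t).1 *
    a (finProdFinEquiv.symm t).2
  rwa [lpNorm_blocks hp _ (fun _ => a), hsingle, hsum] at this

theorem krivineSet_mono {X : Type*} [NormedAddCommGroup X] [NormedSpace ℝ X] (e : ℕ → X) :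
    Monotone (KrivineSet e) := by
  rintro W₂ W₁ hle p ⟨hp, h⟩
  refine ⟨hp, fun n ε hε => ?_⟩
  obtain ⟨y, hy, hyW, hyp⟩ := h n ε hε
  exact ⟨y, hy, fun i => ⟨(hyW i).1, hle (hyW i).2⟩, hyp⟩

theorem krivineSet_subset_of_finite_codim {X : Type*} [NormedAddCommGroup X] [NormedSpace ℝ X]
    (e : ℕ → X) (W₁ W₂ : Submodule ℝ X)
    [FiniteDimensional ℝ (W₁ ⧸ Submodule.comap W₁.subtype W₂)] :
    KrivineSet e W₁ ⊆ KrivineSet e W₂ := by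
  rintro p ⟨hp, h⟩
  refine ⟨hp, fun n ε hε => ?_⟩
  set k := Module.finrank ℝ (W₁ ⧸ Submodule.comap W₁.subtype W₂) + 1
  set C := 1 + min 1 (ε / 3)
  have hmin : 0 < min 1 (ε / 3) := by positivity
  have hC : 0 < C := by positivity
  have hCC : C * C ≤ 1 + ε := by
    nlinarith [min_le_left 1 (ε / 3), min_le_right 1 (ε / 3)]
  obtain ⟨x, hx, hxW, hxp⟩ := h (n * k) _ hmin
  have key : ∀ i : Fin n, ∃ a : Fin k → ℝ, ‖∑ j, a j • x (finProdFinEquiv (i, j))‖ = 1 ∧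
      ∑ j, a j • x (finProdFinEquiv (i, j)) ∈ W₂ := by
    intro i
    obtain ⟨a, ha0, haW⟩ := exists_ne_zero_sum_smul_mem (W₁ := W₁) (W₂ := W₂)
      (Nat.lt_succ_self _) (fun j => x (finProdFinEquiv (i, j))) fun j => (hxW _).2
    have hpos : 0 < ‖∑ j, a j • x (finProdFinEquiv (i, j))‖ :=
      (mul_pos (inv_pos.2 hC) (lpNorm_pos ha0)).trans_le (hxp.norm_block hp i a).1
    refine ⟨fun j => ‖∑ j, a j • x (finProdFinEquiv (i, j))‖⁻¹ * a j, ?_⟩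
    simp only [mul_smul, ← Finset.smul_sum]
    refine ⟨?_, W₂.smul_mem _ haW⟩
    rw [norm_smul, norm_inv, norm_norm, inv_mul_cancel₀ hpos.ne']
  choose a ha haW using key
  refine ⟨fun i => ∑ j, a i j • x (finProdFinEquiv (i, j)), ?_, fun i => ⟨ha i, haW i⟩, ?_⟩
  · exact hx.blocks (Nat.succ_pos _) a fun i => norm_ne_zero_iff.1 ((ha i).trans_ne one_ne_zero)
  · refine (hxp.blocks hC hp a fun i => ?_).mono (mul_pos hC hC) hCC
    obtain ⟨hl, hu⟩ := hxp.norm_block hp i (a i)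
    rw [ha i] at hl hu
    exact ⟨(inv_le_iff_one_le_mul₀' hC).2 hu, by rwa [inv_mul_le_iff₀ hC, mul_one] at hl⟩

/-- If `W₂ ⊆ W₁` are infinite-dimensional block subspaces of `X` then `K(W₂) ⊆ K(W₁)`;
if moreover `W₂` has finite codimension in `W₁` then `K(W₂) = K(W₁)`. -/
theorem krivineSet_mono_and_eq_of_finite_codim {X : Type*} [NormedAddCommGroup X]
    [NormedSpace ℝ X] [CompleteSpace X] (e : ℕ → X) (he : IsSchauderBasis e)
    (W₁ W₂ : Submodule ℝ X) (h₁ : IsBlockSubspace e W₁) (h₂ : IsBlockSubspace e W₂)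
    (hle : W₂ ≤ W₁) :
    KrivineSet e W₂ ⊆ KrivineSet e W₁ ∧
      (FiniteDimensional ℝ (W₁ ⧸ Submodule.comap W₁.subtype W₂) →
        KrivineSet e W₂ = KrivineSet e W₁) := by
  exact ⟨krivineSet_mono e hle, fun _ =>
    (krivineSet_mono e hle).antisymm (krivineSet_subset_of_finite_codim e W₁ W₂)⟩
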